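/- Any function f : X → [-∞,+∞] that solves the fixed point equation (FP) is proper, convex and lower semicontinuous. -/

import Mathlib

open scoped RealInnerProductSpace

/-- The Legendre–Fenchel conjugate of an extended-real-valued function on a real
Hilbert space: `f*(y) = sup_x (⟪y, x⟫ - f x)`. -/
noncomputable def fenchelConj {X : Type*} [NormedAddCommGroup X] [InnerProductSpace ℝ X]
    (f : X → EReal) : X → EReal :=
  fun y => ⨆ x : X, ((⟪y, x⟫ : ℝ) : EReal) - f x

/-- `f` solves the fixed point equation (FP):
`f x = τ · f*(E x + c) + ⟪w, x⟫ + β` for every `x`. -/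
def SolvesFP {X : Type*} [NormedAddCommGroup X] [InnerProductSpace ℝ X]
    (τ : ℝ) (c w : X) (β : ℝ) (E : X ≃L[ℝ] X) (f : X → EReal) : Prop :=
  ∀ x : X, f x = (τ : EReal) * fenchelConj f (E x + c) + ((⟪w, x⟫ : ℝ) : EReal) + (β : EReal)

theorem fp_aux_arith (τ p q r : ℝ) (hτ : 0 < τ) (F : EReal) :
    (τ : EReal) * F + (p : EReal) + (q : EReal) ≤ (r : EReal) ↔
      F ≤ (((r - p - q) / τ : ℝ) : EReal) := by
  induction F with
  | bot => simp [EReal.coe_mul_bot_of_pos hτ]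
  | top =>
    rw [EReal.coe_mul_top_of_pos hτ, EReal.top_add_coe, EReal.top_add_coe]
    simp only [top_le_iff, EReal.coe_ne_top]
  | coe t =>
    rw [← EReal.coe_mul, ← EReal.coe_add, ← EReal.coe_add, EReal.coe_le_coe_iff,
      EReal.coe_le_coe_iff, le_div_iff₀ hτ]
    constructor <;> intro h <;> linarith

theorem fp_aux_key {X : Type*} [NormedAddCommGroup X] [InnerProductSpace ℝ X]
    (τ : ℝ) (hτ : 0 < τ) (c w : X) (β : ℝ) (E : X ≃L[ℝ] X)
    (f : X → EReal) (hf : SolvesFP τ c w β E f) (hbot : ∀ x, f x ≠ ⊥) (x : X) (r : ℝ) :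
    f x ≤ (r : EReal) ↔ ∀ z, f z ≠ ⊤ →
      τ * (⟪E x + c, z⟫ - (f z).toReal) + ⟪w, x⟫ + β ≤ r := by
  rw [hf x, fp_aux_arith _ _ _ _ hτ, fenchelConj, iSup_le_iff]
  refine forall_congr' fun z => ?_
  have hz := hbot z
  generalize f z = g at hz
  induction g with
  | bot => exact absurd rfl hz
  | top => simp
  | coe t =>
    rw [← EReal.coe_sub, EReal.coe_le_coe_iff, le_div_iff₀ hτ]
    simp only [ne_eq, EReal.coe_ne_top, not_false_eq_true, EReal.toReal_coe, forall_const]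
    constructor <;> intro h <;> linarith

/-- any solution of (FP) is proper, convex and lower semicontinuous. -/
theorem solution_of_FP_is_proper_convex_lsc
    {X : Type*} [NormedAddCommGroup X] [InnerProductSpace ℝ X] [CompleteSpace X] [Nontrivial X]
    (τ : ℝ) (hτ : 0 < τ) (c w : X) (β : ℝ) (E : X ≃L[ℝ] X)
    (f : X → EReal) (hf : SolvesFP τ c w β E f) :
    (∀ x : X, f x ≠ ⊥) ∧ (∃ x : X, f x ≠ ⊤) ∧
      (∀ x y : X, ∀ a b : ℝ, 0 ≤ a → 0 ≤ b → a + b = 1 →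
        f (a • x + b • y) ≤ (a : EReal) * f x + (b : EReal) * f y) ∧
      LowerSemicontinuous f := by
  have hbot : ∀ x, f x ≠ ⊥ := by
    intro x hx
    have h1 : ∀ y, fenchelConj f y = ⊤ := by
      intro y
      rw [fenchelConj, eq_top_iff]
      refine le_trans ?_ (le_iSup _ x)
      simp [hx]
    have h2 := hf x
    rw [h1, hx, EReal.coe_mul_top_of_pos hτ, EReal.top_add_coe, EReal.top_add_coe] at h2
    exact absurd h2 (by simp)
  have key := fp_aux_key τ hτ c w β E f hf hbot
  refine ⟨hbot, ?_, ?_, ?_⟩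
  · by_contra hcon
    push Not at hcon
    have := (key 0 0).2 (fun z hz => absurd (hcon z) hz)
    rw [hcon] at this
    simp at this
  · intro x y a b ha hb hab
    rcases ha.eq_or_lt with rfl | ha'
    · have : b = 1 := by linarith
      subst this
      simp
    rcases hb.eq_or_lt with rfl | hb'
    · have : a = 1 := by linarith
      subst this
      simp
    have hx := key x
    have hy := key y
    have hxb := hbot x
    have hyb := hbot y
    have mb : ∀ (t : ℝ) (g : EReal), 0 < t → g ≠ ⊥ → (t : EReal) * g ≠ ⊥ := by
      intro t g ht hg
      induction g with
      | bot => exact absurd rfl hg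
      | top => simp [EReal.coe_mul_top_of_pos ht]
      | coe s => rw [← EReal.coe_mul]; exact EReal.coe_ne_bot _
    by_cases hxt : f x = ⊤
    · rw [hxt, EReal.coe_mul_top_of_pos ha', EReal.top_add_of_ne_bot (mb b _ hb' hyb)]
      exact le_top
    by_cases hyt : f y = ⊤
    · rw [hyt, EReal.coe_mul_top_of_pos hb', EReal.add_top_of_ne_bot (mb a _ ha' hxb)]
      exact le_top
    have ex := EReal.coe_toReal hxt hxb
    have ey := EReal.coe_toReal hyt hyb
    have h1 := (hx (f x).toReal).1 ex.ge
    have h2 := (hy (f y).toReal).1 ey.ge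
    rw [← ex, ← ey, ← EReal.coe_mul, ← EReal.coe_mul, ← EReal.coe_add, key]
    intro z hz
    have h3 := mul_le_mul_of_nonneg_left (h1 z hz) ha
    have h4 := mul_le_mul_of_nonneg_left (h2 z hz) hb
    simp only [map_add, map_smul, inner_add_left, inner_add_right, real_inner_smul_left,
      real_inner_smul_right] at h3 h4 ⊢
    obtain rfl : b = 1 - a := by linarith
    refine le_trans (le_of_eq ?_) (add_le_add h3 h4)
    ring
  · rw [lowerSemicontinuous_iff_isClosed_preimage]
    intro r
    induction r with
    | bot =>
      convert isClosed_empty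
      ext x
      simp [hbot x]
    | top => simp
    | coe r =>
      have : f ⁻¹' Set.Iic (r : EReal) = ⋂ z, ⋂ (_ : f z ≠ ⊤),
          {x | τ * (⟪E x + c, z⟫ - (f z).toReal) + ⟪w, x⟫ + β ≤ r} := by
        ext x
        simp only [Set.mem_preimage, Set.mem_Iic, key, Set.mem_iInter, Set.mem_setOf_eq]
      rw [this]
      refine isClosed_iInter fun z => isClosed_iInter fun _ => isClosed_le ?_ continuous_const
      fun_prop
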